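/- If {a@M; b_1@M_1,…,b_s@M_s} is a tight framelet filter bank with mixed sampling factors, then for every J ∈ ℕ the J-level discrete affine system DAS_J := {a_{J;k} : k∈ℤ^d} ∪ {b_{ℓ,j;k} : k∈ℤ^d, ℓ=1,…,s, j=1,…,J} is a normalized tight frame for ℓ²(ℤ^d), i.e., ‖v‖² = Σ_k |⟨v, a_{J;k}⟩|² + Σ_{j=1}^J Σ_{ℓ=1}^s Σ_k |⟨v, b_{ℓ,j;k}⟩|² for all v ∈ ℓ²(ℤ^d). -/

import Mathlib

open scoped BigOperators
open MeasureTheory Classical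

/-- Convolution of two sequences on ℤ^d. -/
noncomputable def conv {d : ℕ} (v w : (Fin d → ℤ) → ℂ) (n : Fin d → ℤ) : ℂ :=
  ∑' k : Fin d → ℤ, v k * w (n - k)

/-- Upsampling `(v ↑ N)(k) = v (N⁻¹ k)` if `k ∈ Nℤ^d`, and `0` otherwise. -/
noncomputable def up {d : ℕ} (v : (Fin d → ℤ) → ℂ) (N : Matrix (Fin d) (Fin d) ℤ)
    (k : Fin d → ℤ) : ℂ :=
  if h : ∃ m : Fin d → ℤ, N.mulVec m = k then v h.choose else 0

/-- Multilevel low-pass filters: `a_0 = δ`, `a_{j+1} = a_j ∗ (a ↑ M^j)`. -/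
noncomputable def aseq {d : ℕ} (a : (Fin d → ℤ) → ℂ) (M : Matrix (Fin d) (Fin d) ℤ) :
    ℕ → (Fin d → ℤ) → ℂ
  | 0 => fun k => if k = 0 then 1 else 0
  | j + 1 => conv (aseq a M j) (up a (M ^ j))

/-- Multilevel high-pass filters `b_{ℓ,j} = a_{j-1} ∗ (b_ℓ ↑ M^{j-1})`, `j ≥ 1`. -/
noncomputable def bseq {d : ℕ} (a bl : (Fin d → ℤ) → ℂ) (M : Matrix (Fin d) (Fin d) ℤ)
    (j : ℕ) : (Fin d → ℤ) → ℂ :=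
  conv (aseq a M (j - 1)) (up bl (M ^ (j - 1)))

/-- `a_{j;k} = |det M|^{j/2} a_j(· - M^j k)`. -/
noncomputable def ajk {d : ℕ} (a : (Fin d → ℤ) → ℂ) (M : Matrix (Fin d) (Fin d) ℤ)
    (j : ℕ) (k : Fin d → ℤ) : (Fin d → ℤ) → ℂ :=
  fun x => (((|M.det| : ℤ) : ℝ) ^ ((j : ℝ) / 2) : ℝ) * aseq a M j (x - (M ^ j).mulVec k)

/-- `b_{ℓ,j;k} = |det M|^{(j-1)/2} |det M_ℓ|^{1/2} b_{ℓ,j}(· - M^{j-1} M_ℓ k)`. -/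
noncomputable def bjk {d : ℕ} (a bl : (Fin d → ℤ) → ℂ) (M Ml : Matrix (Fin d) (Fin d) ℤ)
    (j : ℕ) (k : Fin d → ℤ) : (Fin d → ℤ) → ℂ :=
  fun x => ((((|M.det| : ℤ) : ℝ) ^ (((j : ℝ) - 1) / 2) : ℝ) *
    (Real.sqrt ((|Ml.det| : ℤ) : ℝ) : ℝ)) *
    bseq a bl M j (x - (M ^ (j - 1)).mulVec (Ml.mulVec k))

/-- Inner product `⟨u,w⟩ = Σ_k u(k) conj (w(k))` on ℓ²(ℤ^d). -/
noncomputable def ip {d : ℕ} (u w : (Fin d → ℤ) → ℂ) : ℂ :=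
  ∑' k : Fin d → ℤ, u k * starRingEnd ℂ (w k)

/-- Fourier series `û(ξ) = Σ_{k∈ℤ^d} u(k) e^{-ik·ξ}`. -/
noncomputable def fserd {d : ℕ} (u : (Fin d → ℤ) → ℂ) (ξ : Fin d → ℝ) : ℂ :=
  ∑' k : Fin d → ℤ, u k * Complex.exp (-(Complex.I * ((∑ i, (k i : ℝ) * ξ i : ℝ) : ℂ)))

/-- `ω ∈ N^{-T} ℤ^d`, i.e. `Nᵀ ω ∈ ℤ^d`. -/
def inLat {d : ℕ} (N : Matrix (Fin d) (Fin d) ℤ) (ω : Fin d → ℝ) : Prop :=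
  ∃ k : Fin d → ℤ, (N.map (Int.cast : ℤ → ℝ)).transpose.mulVec ω = fun i => (k i : ℝ)

/-- `Ω_N = (N^{-T} ℤ^d) ∩ [0,1)^d`. -/
def Omega {d : ℕ} (N : Matrix (Fin d) (Fin d) ℤ) : Set (Fin d → ℝ) :=
  {ω | inLat N ω ∧ ∀ i, ω i ∈ Set.Ico (0 : ℝ) 1}


/-- real pairing -/
noncomputable def dotp {d : ℕ} (k : Fin d → ℤ) (ξ : Fin d → ℝ) : ℝ := ∑ i, (k i : ℝ) * ξ i

theorem mFourier_coe {d : ℕ} (n : Fin d → ℤ) (x : Fin d → ℝ) :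
    UnitAddTorus.mFourier n (fun i => (x i : UnitAddCircle)) =
      Complex.exp (Complex.I * ((dotp n ((2 * Real.pi) • x) : ℝ) : ℂ)) := by
  simp only [UnitAddTorus.mFourier, ContinuousMap.coe_mk, fourier_coe_apply]
  rw [← Complex.exp_sum]
  congr 1
  simp only [dotp, Complex.ofReal_sum, Finset.mul_sum]
  refine Finset.sum_congr rfl fun i _ => ?_
  simp
  ring

theorem fourier_uniq {d : ℕ} (c : (Fin d → ℤ) → ℂ) (hc : Summable fun n => ‖c n‖)
    (h : ∀ᵐ ξ : Fin d → ℝ ∂volume,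
      ∑' n, c n * Complex.exp (Complex.I * ((dotp n ξ : ℝ) : ℂ)) = 0) (m : Fin d → ℤ) :
    c m = 0 := by
  have hcont : Continuous fun ξ : Fin d → ℝ =>
      ∑' n, c n * Complex.exp (Complex.I * ((dotp n ξ : ℝ) : ℂ)) := by
    refine continuous_tsum (u := fun n => ‖c n‖) ?_ hc ?_
    · intro n
      unfold dotp
      fun_prop
    · intro n ξ
      rw [norm_mul, mul_comm Complex.I, Complex.norm_exp_ofReal_mul_I, mul_one]
  have hz : (fun ξ : Fin d → ℝ =>
      ∑' n, c n * Complex.exp (Complex.I * ((dotp n ξ : ℝ) : ℂ))) = fun _ => 0 :=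
    (Continuous.ae_eq_iff_eq (μ := volume) hcont continuous_const).1 h
  have hsum : Summable fun n => c n • (UnitAddTorus.mFourier n : C(UnitAddTorus (Fin d), ℂ)) := by
    refine Summable.of_norm ?_
    simpa [norm_smul, UnitAddTorus.mFourier_norm] using hc
  have hs : HasSum (fun n => c n • (UnitAddTorus.mFourier n : C(UnitAddTorus (Fin d), ℂ))) 0 := by
    convert hsum.hasSum using 1
    ext z
    obtain ⟨x, rfl⟩ : ∃ x : Fin d → ℝ, (fun i => (x i : UnitAddCircle)) = z := by
      choose x hx using fun i => QuotientAddGroup.mk_surjective (z i)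
      exact ⟨x, funext hx⟩
    rw [← ContinuousMap.tsum_apply hsum]
    have := congrFun hz ((2 * Real.pi) • x)
    simp only [ContinuousMap.smul_apply, mFourier_coe, smul_eq_mul, this, ContinuousMap.zero_apply]
  have h2 := hs.mapL (ContinuousMap.toLp (E := ℂ) 2
    (Measure.pi fun _ : Fin d => (AddCircle.haarAddCircle : Measure UnitAddCircle)) ℂ)
  have h3 := h2.mapL (innerSL ℂ (UnitAddTorus.mFourierLp 2 m))
  have ho := orthonormal_iff_ite.1 (UnitAddTorus.orthonormal_mFourier (d := Fin d))
  have h4 : HasSum (fun n => if n = m then c n else 0) 0 := by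
    simp only [map_smul, map_zero, innerSL_apply_apply, smul_eq_mul] at h3
    refine h3.congr_fun fun n => ?_
    have := ho m n
    erw [this]
    by_cases hh : n = m
    · simp [hh]
    · simp [hh, Ne.symm hh]
  have h5 : HasSum (fun n => if n = m then c n else 0) (c m) := hasSum_ite_eq m (c m) |>.congr_fun (by intro n; split_ifs with h <;> simp [h])
  exact h5.unique h4

/-- index of the lattice -/
theorem card_quot {d : ℕ} (N : Matrix (Fin d) (Fin d) ℤ) (hN : N.det ≠ 0) :
    Nat.card ((Fin d → ℤ) ⧸ (LinearMap.range (Matrix.mulVecLin N))) = N.det.natAbs := by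
  have hinj : Function.Injective (Matrix.mulVecLin N) := by
    have := Matrix.mulVec_injective_of_isUnit (A := N)
    rw [← LinearMap.ker_eq_bot]
    exact Matrix.ker_mulVecLin_eq_bot_iff.2 (fun v hv => Matrix.eq_zero_of_mulVec_eq_zero hN hv)
  have := Submodule.natAbs_det_equiv (LinearMap.range (Matrix.mulVecLin N))
    (LinearEquiv.ofInjective _ hinj)
  rw [← this]
  congr 1
  rw [← LinearMap.det_toLin' N]
  congr 1

/-- the unimodular exponential -/
noncomputable def uexp (t : ℝ) : ℂ := Complex.exp (Complex.I * (t : ℂ))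

theorem uexp_add (s t : ℝ) : uexp (s + t) = uexp s * uexp t := by
  simp [uexp, mul_add, Complex.exp_add]

theorem uexp_zero : uexp 0 = 1 := by simp [uexp]

theorem norm_uexp (t : ℝ) : ‖uexp t‖ = 1 := by
  rw [uexp, mul_comm, Complex.norm_exp_ofReal_mul_I]

theorem conj_uexp (t : ℝ) : starRingEnd ℂ (uexp t) = uexp (-t) := by
  simp [uexp, ← Complex.exp_conj]

theorem uexp_eq_one (t : ℝ) : uexp t = 1 ↔ ∃ n : ℤ, t = n * (2 * Real.pi) := by
  rw [uexp, Complex.exp_eq_one_iff]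
  refine exists_congr fun n => ?_
  constructor
  · intro h
    have : Complex.I * (t : ℂ) = Complex.I * ((n * (2 * Real.pi) : ℝ) : ℂ) := by
      rw [h]; push_cast; ring
    exact_mod_cast mul_left_cancel₀ Complex.I_ne_zero this
  · intro h
    rw [h]; push_cast; ring

theorem uexp_sum {ι : Type*} (s : Finset ι) (f : ι → ℝ) :
    uexp (∑ i ∈ s, f i) = ∏ i ∈ s, uexp (f i) := by
  simp only [uexp, Complex.ofReal_sum, Finset.mul_sum, Complex.exp_sum]

theorem uexp_int_mul (n : ℤ) (t : ℝ) : uexp (n * t) = uexp t ^ n := by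
  rw [uexp, uexp, ← Complex.exp_int_mul]
  congr 1
  push_cast
  ring

/-- character -/
noncomputable def chr {d : ℕ} (ω : Fin d → ℝ) (n : Fin d → ℤ) : ℂ :=
  uexp (dotp n ((2 * Real.pi) • ω))

theorem dotp_add_left {d : ℕ} (n m : Fin d → ℤ) (x : Fin d → ℝ) :
    dotp (n + m) x = dotp n x + dotp m x := by
  simp [dotp, add_mul, Finset.sum_add_distrib]

theorem dotp_neg_left {d : ℕ} (n : Fin d → ℤ) (x : Fin d → ℝ) :
    dotp (-n) x = - dotp n x := by
  simp [dotp]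

theorem dotp_add_right {d : ℕ} (n : Fin d → ℤ) (x y : Fin d → ℝ) :
    dotp n (x + y) = dotp n x + dotp n y := by
  simp [dotp, mul_add, Finset.sum_add_distrib]

theorem dotp_smul {d : ℕ} (n : Fin d → ℤ) (c : ℝ) (x : Fin d → ℝ) :
    dotp n (c • x) = c * dotp n x := by
  simp only [dotp, Pi.smul_apply, smul_eq_mul, Finset.mul_sum]
  exact Finset.sum_congr rfl fun i _ => by ring

theorem dotp_mulVec {d : ℕ} (N : Matrix (Fin d) (Fin d) ℤ) (m : Fin d → ℤ) (x : Fin d → ℝ) :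
    dotp (N.mulVec m) x = dotp m ((N.map (Int.cast : ℤ → ℝ)).transpose.mulVec x) := by
  simp only [dotp, Matrix.mulVec, dotProduct, Int.cast_sum, Int.cast_mul, Finset.sum_mul,
    Matrix.transpose_apply, Matrix.map_apply, Finset.mul_sum]
  rw [Finset.sum_comm]
  exact Finset.sum_congr rfl fun i _ => Finset.sum_congr rfl fun j _ => by ring

theorem dotp_single {d : ℕ} (i : Fin d) (x : Fin d → ℝ) :
    dotp (Pi.single i 1) x = x i := by
  simp [dotp, Pi.single_apply]

theorem chr_add {d : ℕ} (ω : Fin d → ℝ) (n m : Fin d → ℤ) :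
    chr ω (n + m) = chr ω n * chr ω m := by
  simp [chr, dotp_add_left, uexp_add]

theorem chr_zero {d : ℕ} (ω : Fin d → ℝ) : chr ω 0 = 1 := by
  simp [chr, dotp, uexp_zero]

theorem chr_zero_left {d : ℕ} (n : Fin d → ℤ) : chr 0 n = 1 := by
  simp [chr, dotp, uexp_zero]

theorem norm_chr {d : ℕ} (ω : Fin d → ℝ) (n : Fin d → ℤ) : ‖chr ω n‖ = 1 := norm_uexp _

theorem chr_mulVec {d : ℕ} {N : Matrix (Fin d) (Fin d) ℤ} {ω : Fin d → ℝ} (h : inLat N ω)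
    (m : Fin d → ℤ) : chr ω (N.mulVec m) = 1 := by
  obtain ⟨k, hk⟩ := h
  rw [chr, uexp_eq_one, dotp_smul, dotp_mulVec, hk]
  refine ⟨∑ i, m i * k i, ?_⟩
  simp [dotp]
  ring

theorem chr_inj {d : ℕ} {ω ω' : Fin d → ℝ} (h : ∀ i, ω i ∈ Set.Ico (0 : ℝ) 1)
    (h' : ∀ i, ω' i ∈ Set.Ico (0 : ℝ) 1) (he : ∀ n, chr ω n = chr ω' n) : ω = ω' := by
  ext i
  have h1 := he (Pi.single i 1)
  simp only [chr, dotp_single, Pi.smul_apply, smul_eq_mul] at h1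
  have h2 : uexp (2 * Real.pi * ω i - 2 * Real.pi * ω' i) = 1 := by
    rw [sub_eq_add_neg, uexp_add, h1, ← uexp_add]; simp [uexp_zero]
  obtain ⟨n, hn⟩ := (uexp_eq_one _).1 h2
  have h3 : ω i - ω' i = n := by
    have : (2 * Real.pi) ≠ 0 := by positivity
    apply mul_left_cancel₀ this
    linarith
  have a1 := h i; have a2 := h' i
  simp only [Set.mem_Ico] at a1 a2
  have l1 : (n : ℝ) < 1 := by linarith
  have l2 : (-1 : ℝ) < n := by linarith
  have l1' : n < 1 := by exact_mod_cast l1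
  have l2' : -1 < n := by exact_mod_cast l2
  have : n = 0 := by omega
  rw [this] at h3
  simp at h3
  linarith

theorem addChar_sum {ι A : Type*} [AddCommGroup A] (ψ : AddChar A ℂ) (s : Finset ι) (f : ι → A) :
    ψ (∑ i ∈ s, f i) = ∏ i ∈ s, ψ (f i) := by
  induction s using Finset.induction_on with
  | empty => simp
  | insert a s ha ih =>
    rw [Finset.sum_insert ha, Finset.prod_insert ha, AddChar.map_add_eq_mul, ih]

theorem exists_char {d : ℕ} (N : Matrix (Fin d) (Fin d) ℤ)
    [Finite ((Fin d → ℤ) ⧸ (LinearMap.range (Matrix.mulVecLin N)))]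
    (ψ : AddChar ((Fin d → ℤ) ⧸ (LinearMap.range (Matrix.mulVecLin N))) ℂ) :
    ∃ ω ∈ Omega N, ∀ n : Fin d → ℤ, ψ (Submodule.Quotient.mk n) = chr ω n := by
  let z : Fin d → ℂ := fun i => ψ (Submodule.Quotient.mk (Pi.single i 1))
  let ω : Fin d → ℝ := fun i => Int.fract (Complex.arg (z i) / (2 * Real.pi))
  have hz : ∀ i, uexp (2 * Real.pi * ω i) = z i := by
    intro i
    have e1 : 2 * Real.pi * ω i = Complex.arg (z i) +
        (-⌊Complex.arg (z i) / (2 * Real.pi)⌋ : ℤ) * (2 * Real.pi) := by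
      simp only [ω, Int.fract]
      push_cast
      field_simp
      ring
    rw [e1, uexp_add, (uexp_eq_one _).2 ⟨_, rfl⟩, mul_one, uexp, mul_comm]
    have := Complex.norm_mul_exp_arg_mul_I (z i)
    rwa [show ‖z i‖ = 1 from AddChar.norm_apply _ _, Complex.ofReal_one, one_mul] at this
  have hchr : ∀ n : Fin d → ℤ, ψ (Submodule.Quotient.mk n) = chr ω n := by
    intro n
    have e : (Submodule.Quotient.mk n : (Fin d → ℤ) ⧸ (LinearMap.range (Matrix.mulVecLin N))) =
        ∑ i, n i • Submodule.Quotient.mk (Pi.single i 1) := by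
      conv_lhs => rw [pi_eq_sum_univ' n]
      simp only [← Submodule.mkQ_apply, map_sum, map_smul]
    rw [e, addChar_sum, chr, dotp, uexp_sum]
    refine Finset.prod_congr rfl fun i _ => ?_
    rw [AddChar.map_zsmul_eq_zpow, uexp_int_mul]
    simp only [Pi.smul_apply, smul_eq_mul, hz]
    rfl
  refine ⟨ω, ⟨?_, fun i => ⟨Int.fract_nonneg _, Int.fract_lt_one _⟩⟩, hchr⟩
  have h1 : ∀ j : Fin d, ∃ k : ℤ,
      (N.map (Int.cast : ℤ → ℝ)).transpose.mulVec ω j = k := by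
    intro j
    have h := hchr (N.mulVecLin (Pi.single j 1))
    rw [(Submodule.Quotient.mk_eq_zero (LinearMap.range (Matrix.mulVecLin N))).2
      (LinearMap.mem_range_self (Matrix.mulVecLin N) (Pi.single j 1)), AddChar.map_zero_eq_one, eq_comm, chr,
      Matrix.mulVecLin_apply,       uexp_eq_one, dotp_smul, dotp_mulVec, dotp_single] at h
    obtain ⟨n, hn⟩ := h
    refine ⟨n, ?_⟩
    have : (2 * Real.pi) ≠ 0 := by positivity
    apply mul_left_cancel₀ this
    linarith
  choose k hk using h1
  exact ⟨k, funext hk⟩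

theorem exists_char' {d : ℕ} (N : Matrix (Fin d) (Fin d) ℤ) (ω : Fin d → ℝ) (hω : inLat N ω) :
    ∃ ψ : AddChar ((Fin d → ℤ) ⧸ (LinearMap.range (Matrix.mulVecLin N))) ℂ,
    ∀ n : Fin d → ℤ, ψ (Submodule.Quotient.mk n) = chr ω n := by
  have hw : ∀ n m : Fin d → ℤ,
      (Submodule.Quotient.mk n : (Fin d → ℤ) ⧸ (LinearMap.range (Matrix.mulVecLin N))) =
        Submodule.Quotient.mk m → chr ω n = chr ω m := by
    intro n m h
    obtain ⟨k, hk⟩ := (Submodule.Quotient.eq _).1 h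
    rw [Matrix.mulVecLin_apply] at hk
    rw [show n = N.mulVec k + m by rw [hk]; abel, chr_add, chr_mulVec hω, one_mul]
  have hs : ∀ q : (Fin d → ℤ) ⧸ (LinearMap.range (Matrix.mulVecLin N)),
      ∃ n, Submodule.Quotient.mk n = q := Submodule.Quotient.mk_surjective _
  choose g hg using hs
  refine ⟨⟨fun q => chr ω (g q), ?_, ?_⟩, ?_⟩
  · rw [← chr_zero ω]
    apply hw
    rw [hg]; rfl
  · intro q r
    rw [← chr_add]
    apply hw
    rw [Submodule.Quotient.mk_add, hg, hg, hg]
  · intro n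
    exact hw _ _ (hg _)

theorem charsum {d : ℕ} (N : Matrix (Fin d) (Fin d) ℤ) (hN : N.det ≠ 0) :
    ∃ S : Finset (Fin d → ℝ), (∀ ω, ω ∈ S ↔ ω ∈ Omega N) ∧ ∀ n : Fin d → ℤ,
      ∑ ω ∈ S, chr ω n = if ∃ k, N.mulVec k = n then (((|N.det| : ℤ) : ℝ) : ℂ) else 0 := by
  have hcard := card_quot N hN
  have hfin : Finite ((Fin d → ℤ) ⧸ (LinearMap.range (Matrix.mulVecLin N))) := by
    apply Nat.finite_of_card_ne_zero
    rw [hcard]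
    simpa using hN
  have := Fintype.ofFinite ((Fin d → ℤ) ⧸ (LinearMap.range (Matrix.mulVecLin N)))
  choose g hg hgc using exists_char N
  have ginj : Function.Injective g := by
    intro ψ φ h
    ext q
    obtain ⟨n, rfl⟩ := Submodule.Quotient.mk_surjective _ q
    rw [hgc, hgc, h]
  refine ⟨Finset.univ.image g, ?_, ?_⟩
  · intro ω
    simp only [Finset.mem_image, Finset.mem_univ, true_and]
    constructor
    · rintro ⟨ψ, rfl⟩
      exact hg ψ
    · intro h
      obtain ⟨ψ, hψ⟩ := exists_char' N ω h.1
      refine ⟨ψ, chr_inj (hg ψ).2 h.2 fun n => ?_⟩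
      rw [← hgc, hψ]
  · intro n
    rw [Finset.sum_image ginj.injOn]
    simp only [← hgc]
    rw [AddChar.sum_apply_eq_ite]
    rw [← Nat.card_eq_fintype_card, hcard]
    refine if_congr ?_ ?_ rfl
    · rw [Submodule.Quotient.mk_eq_zero]
      rfl
    · rw [← Int.cast_natCast, Int.natCast_natAbs]
      norm_cast

theorem fserd_eq {d : ℕ} (f : (Fin d → ℤ) → ℂ) (ξ : Fin d → ℝ) :
    fserd f ξ = ∑' k, f k * uexp (-(dotp k ξ)) := by
  unfold fserd
  refine tsum_congr fun k => ?_
  rw [uexp, dotp]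
  congr 2
  push_cast
  ring

/-- autocorrelation -/
noncomputable def corr {d : ℕ} (f : (Fin d → ℤ) → ℂ) (ω : Fin d → ℝ) (n : Fin d → ℤ) : ℂ :=
  ∑' u, f u * starRingEnd ℂ (f (u + n)) * chr ω (u + n)

/-- shear -/
def shear (G : Type*) [AddCommGroup G] : G × G ≃ G × G where
  toFun p := (p.2, p.2 + p.1)
  invFun p := (p.2 - p.1, p.1)
  left_inv p := by simp
  right_inv p := by simp

theorem corr_summable_aux {d : ℕ} (f : (Fin d → ℤ) → ℂ) (hf : Summable fun k => ‖f k‖)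
    (ω : Fin d → ℝ) :
    Summable fun p : (Fin d → ℤ) × (Fin d → ℤ) =>
      ‖f p.2 * starRingEnd ℂ (f (p.2 + p.1)) * chr ω (p.2 + p.1)‖ := by
  have h := (shear (Fin d → ℤ)).summable_iff.2 (hf.mul_of_nonneg hf (fun _ => norm_nonneg _)
    (fun _ => norm_nonneg _))
  refine h.congr fun p => ?_
  simp [shear, norm_chr]

theorem corr_summable {d : ℕ} (f : (Fin d → ℤ) → ℂ) (hf : Summable fun k => ‖f k‖)
    (ω : Fin d → ℝ) : Summable fun n => ‖corr f ω n‖ := by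
  have h := corr_summable_aux f hf ω
  refine Summable.of_nonneg_of_le (fun _ => norm_nonneg _) (fun n => ?_) h.prod
  exact norm_tsum_le_tsum_norm (h.prod_factor n)

theorem fserd_mul {d : ℕ} (f : (Fin d → ℤ) → ℂ) (hf : Summable fun k => ‖f k‖)
    (ω ξ : Fin d → ℝ) :
    fserd f ξ * starRingEnd ℂ (fserd f (ξ + (2 * Real.pi) • ω)) =
      ∑' n, corr f ω n * uexp (dotp n ξ) := by
  have h := corr_summable_aux f hf ω
  have e1 : starRingEnd ℂ (fserd f (ξ + (2 * Real.pi) • ω)) =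
      ∑' k, starRingEnd ℂ (f k) * uexp (dotp k (ξ + (2 * Real.pi) • ω)) := by
    rw [fserd_eq, Complex.conj_tsum]
    refine tsum_congr fun k => ?_
    rw [map_mul, conj_uexp, neg_neg]
  rw [e1, fserd_eq, tsum_mul_tsum_of_summable_norm (by simpa [norm_uexp] using hf)
    (by simpa [norm_uexp] using hf), ← (shear (Fin d → ℤ)).tsum_eq]
  have e2 : ∀ p : (Fin d → ℤ) × (Fin d → ℤ),
      f ((shear (Fin d → ℤ)) p).1 * uexp (-(dotp ((shear (Fin d → ℤ)) p).1 ξ)) *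
      (starRingEnd ℂ (f ((shear (Fin d → ℤ)) p).2) *
        uexp (dotp ((shear (Fin d → ℤ)) p).2 (ξ + (2 * Real.pi) • ω))) =
      f p.2 * starRingEnd ℂ (f (p.2 + p.1)) * chr ω (p.2 + p.1) * uexp (dotp p.1 ξ) := by
    intro p
    simp only [shear, Equiv.coe_fn_mk, chr]
    have : uexp (-(dotp p.2 ξ)) * uexp (dotp (p.2 + p.1) (ξ + (2 * Real.pi) • ω)) =
        uexp (dotp (p.2 + p.1) ((2 * Real.pi) • ω)) * uexp (dotp p.1 ξ) := by
      rw [← uexp_add, ← uexp_add, dotp_add_right, dotp_add_left p.2 p.1 ξ]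
      congr 1
      ring
    linear_combination (f p.2 * starRingEnd ℂ (f (p.2 + p.1))) * this
  rw [tsum_congr e2]
  have h2 : Summable fun p : (Fin d → ℤ) × (Fin d → ℤ) =>
      f p.2 * starRingEnd ℂ (f (p.2 + p.1)) * chr ω (p.2 + p.1) * uexp (dotp p.1 ξ) := by
    apply Summable.of_norm
    simpa [norm_uexp] using h
  rw [h2.tsum_prod]
  refine tsum_congr fun n => ?_
  dsimp only
  rw [corr, tsum_mul_right]

theorem mulVec_inj {d : ℕ} {N : Matrix (Fin d) (Fin d) ℤ} (hN : N.det ≠ 0) :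
    Function.Injective N.mulVec := by
  intro x y h
  rw [← sub_eq_zero]
  apply Matrix.eq_zero_of_mulVec_eq_zero hN
  rw [Matrix.mulVec_sub, sub_eq_zero]
  exact h

theorem ker_eq {d : ℕ} (f : (Fin d → ℤ) → ℂ) (hf : Summable fun k => ‖f k‖)
    (N : Matrix (Fin d) (Fin d) ℤ) (hN : N.det ≠ 0) (S : Finset (Fin d → ℝ))
    (hS : ∀ n : Fin d → ℤ,
      ∑ ω ∈ S, chr ω n = if ∃ k, N.mulVec k = n then (((|N.det| : ℤ) : ℝ) : ℂ) else 0)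
    (x y : Fin d → ℤ) :
    (((|N.det| : ℤ) : ℝ) : ℂ) * ∑' k, f (x - N.mulVec k) * starRingEnd ℂ (f (y - N.mulVec k)) =
      ∑ ω ∈ S, chr ω (-y) * corr f ω (y - x) := by
  have hinj : Function.Injective fun k => x - N.mulVec k := by
    intro k l h
    exact mulVec_inj hN (by simpa using h)
  have hs : ∀ ω, Summable fun u =>
      chr ω (-y) * (f u * starRingEnd ℂ (f (u + (y - x))) * chr ω (u + (y - x))) := fun ω =>
    ((corr_summable_aux f hf ω).prod_factor (y - x)).of_norm.mul_left _
  simp only [corr, ← tsum_mul_left]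
  rw [← Summable.tsum_finsetSum fun ω _ => hs ω]
  have e : ∀ u, ∑ ω ∈ S, chr ω (-y) * (f u * starRingEnd ℂ (f (u + (y - x))) * chr ω (u + (y - x)))
      = f u * starRingEnd ℂ (f (u + (y - x))) *
        if ∃ k, N.mulVec k = u - x then (((|N.det| : ℤ) : ℝ) : ℂ) else 0 := by
    intro u
    rw [← hS, Finset.mul_sum]
    refine Finset.sum_congr rfl fun ω _ => ?_
    rw [show u - x = -y + (u + (y - x)) by abel, chr_add ω (-y)]
    ring
  rw [tsum_congr e]
  symm
  rw [← hinj.tsum_eq]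
  · refine tsum_congr fun k => ?_
    rw [if_pos ⟨-k, by rw [Matrix.mulVec_neg]; abel⟩,
      show x - N.mulVec k + (y - x) = y - N.mulVec k by abel]
    ring
  · intro u hu
    have : ∃ k, N.mulVec k = u - x := by
      by_contra hcon
      simp [hcon] at hu
    obtain ⟨k, hk⟩ := this
    exact ⟨-k, by simp only [Matrix.mulVec_neg, hk]; abel⟩

theorem kernel_id {d : ℕ} {ι : Type*} [Fintype ι] [Nonempty ι] (f : ι → (Fin d → ℤ) → ℂ)
    (hf : ∀ i, Summable fun k => ‖f i k‖) (N : ι → Matrix (Fin d) (Fin d) ℤ)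
    (hN : ∀ i, (N i).det ≠ 0)
    (h : ∀ ω ∈ ⋃ i, Omega (N i), ∀ᵐ ξ : Fin d → ℝ ∂volume,
      ∑ i, (if inLat (N i) ω then (1 : ℂ) else 0) * (fserd (f i) ξ *
            starRingEnd ℂ (fserd (f i) (ξ + (2 * Real.pi) • ω))) = if ω = 0 then 1 else 0)
    (x y : Fin d → ℤ) :
    ∑ i, (((|(N i).det| : ℤ) : ℝ) : ℂ) *
      ∑' k, f i (x - (N i).mulVec k) * starRingEnd ℂ (f i (y - (N i).mulVec k)) =
      if x = y then 1 else 0 := by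
  have key : ∀ ω ∈ ⋃ i, Omega (N i), ∀ n,
      ∑ i, (if inLat (N i) ω then (1 : ℂ) else 0) * corr (f i) ω n =
        if ω = 0 then (if n = 0 then 1 else 0) else 0 := by
    intro ω hω n
    rw [← sub_eq_zero]
    have hs0 : ∀ i, Summable fun n => ‖(if inLat (N i) ω then (1 : ℂ) else 0) * corr (f i) ω n‖ := by
      intro i
      simp only [norm_mul]
      exact (corr_summable (f i) (hf i) ω).mul_left _
    have hs1 : Summable fun n =>
        ‖∑ i, (if inLat (N i) ω then (1 : ℂ) else 0) * corr (f i) ω n‖ :=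
      Summable.of_nonneg_of_le (fun _ => norm_nonneg _) (fun n => norm_sum_le _ _)
        (summable_sum fun i _ => hs0 i)
    have hfs : (Function.support fun n : Fin d → ℤ =>
        (if ω = 0 then (if n = 0 then (1 : ℂ) else 0) else 0)) ⊆ ({0} : Finset (Fin d → ℤ)) := by
      intro n hn
      by_contra hcon
      simp at hcon
      simp [hcon] at hn
    have hs2 : Summable fun n : Fin d → ℤ =>
        ‖(if ω = 0 then (if n = 0 then (1 : ℂ) else 0) else 0)‖ := by
      apply summable_of_ne_finset_zero (s := {0})
      intro n hn
      simp at hn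
      simp [hn]
    refine fourier_uniq (fun n => ∑ i, (if inLat (N i) ω then (1 : ℂ) else 0) * corr (f i) ω n -
        if ω = 0 then (if n = 0 then 1 else 0) else 0) ?_ ?_ n
    · exact Summable.of_nonneg_of_le (fun _ => norm_nonneg _) (fun n => norm_sub_le _ _)
        (hs1.add hs2)
    · filter_upwards [h ω hω] with ξ hξ
      change ∑' n, _ * uexp (dotp n ξ) = 0
      simp only [sub_mul]
      rw [Summable.tsum_sub, sub_eq_zero]
      · have e2 : ∑' n : Fin d → ℤ, (if ω = 0 then (if n = 0 then (1 : ℂ) else 0) else 0) *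
            uexp (dotp n ξ) = if ω = 0 then 1 else 0 := by
          rw [tsum_eq_single 0]
          · simp [dotp, uexp_zero]
          · intro n hn
            simp [hn]
        rw [e2, ← hξ]
        simp only [Finset.sum_mul]
        rw [Summable.tsum_finsetSum]
        · refine Finset.sum_congr rfl fun i _ => ?_
          rw [fserd_mul _ (hf i), ← tsum_mul_left]
          exact tsum_congr fun n => by ring
        · intro i _
          apply Summable.of_norm
          simpa only [norm_mul, norm_uexp, mul_one] using hs0 i
      · apply Summable.of_norm
        simpa only [norm_mul, norm_uexp, mul_one] using hs1
      · apply Summable.of_norm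
        simpa only [norm_mul, norm_uexp, mul_one] using hs2
  choose S hS hS' using fun i => charsum (N i) (hN i)
  have e1 : ∀ i, (((|(N i).det| : ℤ) : ℝ) : ℂ) *
      ∑' k, f i (x - (N i).mulVec k) * starRingEnd ℂ (f i (y - (N i).mulVec k)) =
      ∑ ω ∈ Finset.univ.biUnion S,
        chr ω (-y) * ((if inLat (N i) ω then (1 : ℂ) else 0) * corr (f i) ω (y - x)) := by
    intro i
    rw [ker_eq (f i) (hf i) (N i) (hN i) (S i) (hS' i) x y]
    refine Finset.sum_subset_zero_on_sdiff (Finset.subset_biUnion_of_mem S (Finset.mem_univ i)) ?_ ?_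
    · intro ω hω
      simp only [Finset.mem_sdiff, Finset.mem_biUnion, Finset.mem_univ, true_and] at hω
      obtain ⟨⟨j, hj⟩, hn⟩ := hω
      have : ¬ inLat (N i) ω := fun hl => hn ((hS i ω).2 ⟨hl, ((hS j ω).1 hj).2⟩)
      simp [this]
    · intro ω hω
      rw [if_pos ((hS i ω).1 hω).1, one_mul]
  simp only [e1]
  rw [Finset.sum_comm]
  simp only [← Finset.mul_sum]
  have e2 : ∀ ω ∈ Finset.univ.biUnion S,
      chr ω (-y) * ∑ i, (if inLat (N i) ω then (1 : ℂ) else 0) * corr (f i) ω (y - x) =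
      if ω = 0 then (if x = y then 1 else 0) else 0 := by
    intro ω hω
    simp only [Finset.mem_biUnion, Finset.mem_univ, true_and] at hω
    obtain ⟨j, hj⟩ := hω
    rw [key ω (Set.mem_iUnion.2 ⟨j, (hS j ω).1 hj⟩)]
    by_cases h0 : ω = 0
    · subst h0
      simp [chr_zero_left, sub_eq_zero, eq_comm]
    · simp [h0]
  rw [Finset.sum_congr rfl e2, Finset.sum_ite_eq']
  rw [if_pos]
  simp only [Finset.mem_biUnion, Finset.mem_univ, true_and]
  obtain ⟨i⟩ := ‹Nonempty ι›
  refine ⟨i, (hS i 0).2 ⟨⟨0, ?_⟩, ?_⟩⟩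
  · ext j; simp
  · intro j; simp

theorem bdd_of_sq {α : Type*} {v : α → ℂ} (hv : Summable fun k => ‖v k‖ ^ 2) :
    ∃ C, ∀ k, ‖v k‖ ≤ C := by
  refine ⟨Real.sqrt (∑' k, ‖v k‖ ^ 2), fun k => ?_⟩
  apply Real.le_sqrt_of_sq_le
  exact hv.le_tsum k (fun _ _ => by positivity)

theorem mul_summable {α : Type*} {v w : α → ℂ} (hv : Summable fun k => ‖v k‖ ^ 2)
    (hw : Summable fun k => ‖w k‖) : Summable fun k => ‖v k * w k‖ := by
  obtain ⟨C, hC⟩ := bdd_of_sq hv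
  refine Summable.of_nonneg_of_le (fun _ => norm_nonneg _) (fun k => ?_) (hw.mul_left C)
  rw [norm_mul]
  exact mul_le_mul_of_nonneg_right (hC k) (norm_nonneg _)

theorem shift_summable {d : ℕ} {f : (Fin d → ℤ) → ℂ} (hf : Summable fun k => ‖f k‖)
    (z : Fin d → ℤ) : Summable fun x => ‖f (x - z)‖ :=
  (Equiv.subRight z).summable_iff (f := fun x => ‖f x‖) |>.2 hf

theorem triple_summable {d : ℕ} (f : (Fin d → ℤ) → ℂ) (hf : Summable fun k => ‖f k‖)
    (N : Matrix (Fin d) (Fin d) ℤ) (hN : N.det ≠ 0) (v : (Fin d → ℤ) → ℂ)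
    (hv : Summable fun k => ‖v k‖ ^ 2) :
    Summable fun p : (Fin d → ℤ) × (Fin d → ℤ) × (Fin d → ℤ) =>
      ((starRingEnd ℂ (v p.2.1) * f (p.2.1 - N.mulVec p.1)) *
        (v p.2.2 * starRingEnd ℂ (f (p.2.2 - N.mulVec p.1)))) := by
  have hF : Summable fun q : (Fin d → ℤ) × (Fin d → ℤ) × (Fin d → ℤ) =>
      ‖v q.1‖ ^ 2 * (‖f q.2.1‖ * ‖f q.2.2‖) :=
    hv.mul_of_nonneg (hf.mul_of_nonneg hf (fun _ => norm_nonneg _) (fun _ => norm_nonneg _))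
      (fun _ => by positivity) (fun _ => mul_nonneg (norm_nonneg _) (norm_nonneg _))
  have i1 : Function.Injective fun p : (Fin d → ℤ) × (Fin d → ℤ) × (Fin d → ℤ) =>
      (p.2.1, p.2.1 - N.mulVec p.1, p.2.2 - N.mulVec p.1) := by
    rintro ⟨k, x, y⟩ ⟨k₂, x₂, y₂⟩ h
    simp only [Prod.mk.injEq] at h
    obtain ⟨rfl, h2, h3⟩ := h
    have : k = k₂ := mulVec_inj hN (by simpa using h2)
    subst this
    simpa using h3
  have i2 : Function.Injective fun p : (Fin d → ℤ) × (Fin d → ℤ) × (Fin d → ℤ) =>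
      (p.2.2, p.2.1 - N.mulVec p.1, p.2.2 - N.mulVec p.1) := by
    rintro ⟨k, x, y⟩ ⟨k₂, x₂, y₂⟩ h
    simp only [Prod.mk.injEq] at h
    obtain ⟨rfl, h2, h3⟩ := h
    have : k = k₂ := mulVec_inj hN (by simpa using h3)
    subst this
    simpa using h2
  apply Summable.of_norm
  refine Summable.of_nonneg_of_le (fun _ => norm_nonneg _) ?_
    ((hF.comp_injective i1).add (hF.comp_injective i2))
  rintro ⟨k, x, y⟩
  simp only [norm_mul, RCLike.norm_conj, Function.comp]
  have h1 : ‖v x‖ * ‖v y‖ ≤ ‖v x‖ ^ 2 + ‖v y‖ ^ 2 := by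
    nlinarith [sq_nonneg (‖v x‖ - ‖v y‖), sq_nonneg (‖v x‖), sq_nonneg (‖v y‖)]
  have h2 : 0 ≤ ‖f (x - N.mulVec k)‖ * ‖f (y - N.mulVec k)‖ := by positivity
  nlinarith [mul_le_mul_of_nonneg_right h1 h2]

/-- scaled shift -/
noncomputable def frm {d : ℕ} (f : (Fin d → ℤ) → ℂ) (N : Matrix (Fin d) (Fin d) ℤ)
    (k x : Fin d → ℤ) : ℂ :=
  (Real.sqrt ((|N.det| : ℤ) : ℝ) : ℂ) * f (x - N.mulVec k)

theorem norm_ip_frm {d : ℕ} (f : (Fin d → ℤ) → ℂ) (hf : Summable fun k => ‖f k‖)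
    (N : Matrix (Fin d) (Fin d) ℤ) (v : (Fin d → ℤ) → ℂ)
    (hv : Summable fun k => ‖v k‖ ^ 2) (k : Fin d → ℤ) :
    ((‖ip v (frm f N k)‖ ^ 2 : ℝ) : ℂ) = (((|N.det| : ℤ) : ℝ) : ℂ) *
      ∑' q : (Fin d → ℤ) × (Fin d → ℤ), ((starRingEnd ℂ (v q.1) * f (q.1 - N.mulVec k)) *
        (v q.2 * starRingEnd ℂ (f (q.2 - N.mulVec k)))) := by
  have e1 : ip v (frm f N k) = (Real.sqrt ((|N.det| : ℤ) : ℝ) : ℂ) *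
      ∑' x, v x * starRingEnd ℂ (f (x - N.mulVec k)) := by
    rw [ip, ← tsum_mul_left]
    refine tsum_congr fun x => ?_
    rw [frm, map_mul, Complex.conj_ofReal]
    ring
  have hs := mul_summable hv (shift_summable hf (N.mulVec k))
  rw [← tsum_mul_tsum_of_summable_norm (f := fun x => starRingEnd ℂ (v x) * f (x - N.mulVec k))
    (g := fun x => v x * starRingEnd ℂ (f (x - N.mulVec k)))
    (by simpa using hs) (by simpa using hs), e1, norm_mul, mul_pow, Complex.ofReal_mul]
  congr 1
  · rw [Complex.norm_real, Real.norm_eq_abs, sq_abs, Real.sq_sqrt]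
    exact_mod_cast abs_nonneg _
  · rw [Complex.ofReal_pow, ← Complex.conj_mul', Complex.conj_tsum]
    congr 1
    exact tsum_congr fun x => by simp

theorem ip_frm_summable {d : ℕ} (f : (Fin d → ℤ) → ℂ) (hf : Summable fun k => ‖f k‖)
    (N : Matrix (Fin d) (Fin d) ℤ) (hN : N.det ≠ 0) (v : (Fin d → ℤ) → ℂ)
    (hv : Summable fun k => ‖v k‖ ^ 2) :
    Summable fun k => ‖ip v (frm f N k)‖ ^ 2 := by
  rw [← Complex.summable_ofReal]
  simp only [norm_ip_frm f hf N v hv]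
  exact (triple_summable f hf N hN v hv).prod.mul_left _

theorem one_level {d : ℕ} {ι : Type*} [Fintype ι] (f : ι → (Fin d → ℤ) → ℂ)
    (hf : ∀ i, Summable fun k => ‖f i k‖) (N : ι → Matrix (Fin d) (Fin d) ℤ)
    (hN : ∀ i, (N i).det ≠ 0)
    (hK : ∀ x y : Fin d → ℤ, ∑ i, (((|(N i).det| : ℤ) : ℝ) : ℂ) *
      ∑' k, f i (x - (N i).mulVec k) * starRingEnd ℂ (f i (y - (N i).mulVec k)) =
      if x = y then 1 else 0) (v : (Fin d → ℤ) → ℂ)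
    (hv : Summable fun k => ‖v k‖ ^ 2) :
    ∑' k, ‖v k‖ ^ 2 = ∑ i, ∑' k, ‖ip v (frm (f i) (N i) k)‖ ^ 2 := by
  rw [← Complex.ofReal_inj]
  simp only [Complex.ofReal_sum, Complex.ofReal_tsum]
  simp only [norm_ip_frm _ (hf _) _ v hv, tsum_mul_left]
  have hT := fun i => triple_summable (f i) (hf i) (N i) (hN i) v hv
  have e1 : ∀ i, ∑' (k : Fin d → ℤ) (q : (Fin d → ℤ) × (Fin d → ℤ)),
      ((starRingEnd ℂ (v q.1) * f i (q.1 - (N i).mulVec k)) *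
        (v q.2 * starRingEnd ℂ (f i (q.2 - (N i).mulVec k)))) =
      ∑' q : (Fin d → ℤ) × (Fin d → ℤ), (starRingEnd ℂ (v q.1) * v q.2) *
        ∑' k, f i (q.1 - (N i).mulVec k) * starRingEnd ℂ (f i (q.2 - (N i).mulVec k)) := by
    intro i
    rw [← Summable.tsum_comm (f := fun (k : Fin d → ℤ) (q : (Fin d → ℤ) × (Fin d → ℤ)) =>
      ((starRingEnd ℂ (v q.1) * f i (q.1 - (N i).mulVec k)) *
        (v q.2 * starRingEnd ℂ (f i (q.2 - (N i).mulVec k))))) (hT i)]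
    refine tsum_congr fun q => ?_
    rw [← tsum_mul_left]
    exact tsum_congr fun k => by ring
  have hs : ∀ i, Summable fun q : (Fin d → ℤ) × (Fin d → ℤ) => (((|(N i).det| : ℤ) : ℝ) : ℂ) *
      ((starRingEnd ℂ (v q.1) * v q.2) *
        ∑' k, f i (q.1 - (N i).mulVec k) * starRingEnd ℂ (f i (q.2 - (N i).mulVec k))) := by
    intro i
    apply Summable.mul_left
    refine (hT i).prod_symm.prod.congr fun q => ?_
    rw [← tsum_mul_left]
    exact tsum_congr fun k => by simp only [Prod.swap]; ring
  simp only [e1, ← tsum_mul_left]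
  simp only [tsum_mul_left]
  have e2 : ∀ i, (((|(N i).det| : ℤ) : ℝ) : ℂ) *
      ∑' q : (Fin d → ℤ) × (Fin d → ℤ), (starRingEnd ℂ (v q.1) * v q.2) *
        ∑' k, f i (q.1 - (N i).mulVec k) * starRingEnd ℂ (f i (q.2 - (N i).mulVec k)) =
      ∑' q : (Fin d → ℤ) × (Fin d → ℤ), (((|(N i).det| : ℤ) : ℝ) : ℂ) *
      ((starRingEnd ℂ (v q.1) * v q.2) *
        ∑' k, f i (q.1 - (N i).mulVec k) * starRingEnd ℂ (f i (q.2 - (N i).mulVec k))) := by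
    intro i
    rw [tsum_mul_left]
  rw [Finset.sum_congr rfl fun i _ => e2 i, ← Summable.tsum_finsetSum fun i _ => hs i]
  have e3 : ∀ q : (Fin d → ℤ) × (Fin d → ℤ), ∑ i, (((|(N i).det| : ℤ) : ℝ) : ℂ) *
      ((starRingEnd ℂ (v q.1) * v q.2) *
        ∑' k, f i (q.1 - (N i).mulVec k) * starRingEnd ℂ (f i (q.2 - (N i).mulVec k))) =
      (starRingEnd ℂ (v q.1) * v q.2) * if q.1 = q.2 then 1 else 0 := by
    intro q
    rw [← hK, Finset.mul_sum]
    exact Finset.sum_congr rfl fun i _ => by ring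
  have hs2 := (summable_sum fun i (_ : i ∈ Finset.univ) => hs i).congr e3
  rw [tsum_congr e3, Summable.tsum_prod hs2]
  refine tsum_congr fun x => ?_
  rw [tsum_eq_single x]
  · simp [Complex.conj_mul']
  · intro y hy
    simp [Ne.symm hy]

theorem up_mulVec {d : ℕ} (f : (Fin d → ℤ) → ℂ) {P : Matrix (Fin d) (Fin d) ℤ} (hP : P.det ≠ 0)
    (m : Fin d → ℤ) : up f P (P.mulVec m) = f m := by
  have h : ∃ n : Fin d → ℤ, P.mulVec n = P.mulVec m := ⟨m, rfl⟩
  rw [up, dif_pos h, mulVec_inj hP h.choose_spec]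

theorem conv_up {d : ℕ} (p f : (Fin d → ℤ) → ℂ) {P : Matrix (Fin d) (Fin d) ℤ} (hP : P.det ≠ 0)
    (z : Fin d → ℤ) : conv p (up f P) z = ∑' m, p (z - P.mulVec m) * f m := by
  have hinj : Function.Injective fun m => z - P.mulVec m := by
    intro k l h
    exact mulVec_inj hP (by simpa using h)
  rw [conv, ← hinj.tsum_eq]
  · refine tsum_congr fun m => ?_
    rw [sub_sub_cancel, up_mulVec f hP]
  · intro k hk
    have : ∃ m, P.mulVec m = z - k := by
      by_contra hcon
      simp [up, hcon] at hk
    obtain ⟨m, hm⟩ := this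
    exact ⟨m, by simp only [hm]; abel⟩

theorem pair_summable {d : ℕ} {p f : (Fin d → ℤ) → ℂ} (hp : Summable fun k => ‖p k‖)
    (hf : Summable fun k => ‖f k‖) (P : Matrix (Fin d) (Fin d) ℤ) (y : Fin d → ℤ) :
    Summable fun q : (Fin d → ℤ) × (Fin d → ℤ) => ‖p (q.1 - P.mulVec q.2)‖ * ‖f (q.2 - y)‖ := by
  have i : Function.Injective fun q : (Fin d → ℤ) × (Fin d → ℤ) =>
      (q.1 - P.mulVec q.2, q.2 - y) := by
    rintro ⟨x, n⟩ ⟨x₂, n₂⟩ h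
    simp only [Prod.mk.injEq, sub_left_inj] at h
    obtain ⟨h1, rfl⟩ := h
    simpa using h1
  have hF : Summable fun q : (Fin d → ℤ) × (Fin d → ℤ) => ‖p q.1‖ * ‖f q.2‖ :=
    hp.mul_of_nonneg hf (fun _ => norm_nonneg _) (fun _ => norm_nonneg _)
  have hG := hF.comp_injective i
  simpa only [Function.comp_def] using hG

theorem conv_up_summable {d : ℕ} {p f : (Fin d → ℤ) → ℂ} (hp : Summable fun k => ‖p k‖)
    (hf : Summable fun k => ‖f k‖) {P : Matrix (Fin d) (Fin d) ℤ} (hP : P.det ≠ 0) :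
    Summable fun z => ‖conv p (up f P) z‖ := by
  have h := pair_summable hp hf P 0
  simp only [sub_zero] at h
  refine Summable.of_nonneg_of_le (fun _ => norm_nonneg _) (fun z => ?_) h.prod
  rw [conv_up p f hP]
  have h2 := h.prod_factor z
  simp only [← norm_mul] at h2 ⊢
  exact norm_tsum_le_tsum_norm h2

theorem aseq_summable {d : ℕ} {a : (Fin d → ℤ) → ℂ} (ha : Summable fun k => ‖a k‖)
    {M : Matrix (Fin d) (Fin d) ℤ} (hM : M.det ≠ 0) (j : ℕ) :
    Summable fun k => ‖aseq a M j k‖ := by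
  induction j with
  | zero =>
    apply summable_of_ne_finset_zero (s := {0})
    intro n hn
    simp at hn
    simp [aseq, hn]
  | succ j ih =>
    exact conv_up_summable ih ha (by rw [Matrix.det_pow]; exact pow_ne_zero _ hM)

theorem cascade {d : ℕ} {p f : (Fin d → ℤ) → ℂ} (hp : Summable fun k => ‖p k‖)
    (hf : Summable fun k => ‖f k‖) {P : Matrix (Fin d) (Fin d) ℤ} (hP : P.det ≠ 0)
    (v : (Fin d → ℤ) → ℂ) (hv : Summable fun k => ‖v k‖ ^ 2) (α β : ℂ) (y : Fin d → ℤ) :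
    ip v (fun x => (α * β) * conv p (up f P) (x - P.mulVec y)) =
      ip (fun n => ip v (fun x => α * p (x - P.mulVec n))) (fun n => β * f (n - y)) := by
  obtain ⟨C, hC⟩ := bdd_of_sq hv
  have hs : Summable (Function.uncurry fun x n : Fin d → ℤ =>
      v x * starRingEnd ℂ (α * p (x - P.mulVec n)) * starRingEnd ℂ (β * f (n - y))) := by
    apply Summable.of_norm
    refine Summable.of_nonneg_of_le (fun _ => norm_nonneg _) ?_
      ((pair_summable hp hf P y).mul_left (C * ‖α‖ * ‖β‖))
    rintro ⟨x, n⟩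
    simp only [Function.uncurry_apply_pair, norm_mul, RCLike.norm_conj]
    have h1 : 0 ≤ ‖α‖ * ‖β‖ * (‖p (x - P.mulVec n)‖ * ‖f (n - y)‖) := by positivity
    nlinarith [mul_le_mul_of_nonneg_right (hC x) h1]
  unfold ip
  have e1 : ∀ n, (∑' x, v x * starRingEnd ℂ (α * p (x - P.mulVec n))) *
      starRingEnd ℂ (β * f (n - y)) =
      ∑' x, v x * starRingEnd ℂ (α * p (x - P.mulVec n)) * starRingEnd ℂ (β * f (n - y)) :=
    fun n => tsum_mul_right.symm
  rw [tsum_congr e1, Summable.tsum_comm hs]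
  refine tsum_congr fun x => ?_
  dsimp only
  rw [conv_up p f hP, ← (Equiv.subRight y).tsum_eq, map_mul, Complex.conj_tsum, ← tsum_mul_left,
    ← tsum_mul_left]
  refine tsum_congr fun n => ?_
  simp only [Equiv.subRight_apply, map_mul]
  rw [show x - P.mulVec y - P.mulVec (n - y) = x - P.mulVec n by rw [Matrix.mulVec_sub]; abel]
  ring

theorem das_aux {d s : ℕ} (a : (Fin d → ℤ) → ℂ) (b : Fin s → (Fin d → ℤ) → ℂ)
    (ha : Summable fun k => ‖a k‖) (hb : ∀ ℓ, Summable fun k => ‖b ℓ k‖)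
    (M : Matrix (Fin d) (Fin d) ℤ) (Ml : Fin s → Matrix (Fin d) (Fin d) ℤ)
    (hM : M.det ≠ 0)
    (h1 : ∀ v : (Fin d → ℤ) → ℂ, Summable (fun k => ‖v k‖ ^ 2) →
      ∑' k, ‖v k‖ ^ 2 = ∑' k, ‖ip v (frm a M k)‖ ^ 2 +
        ∑ ℓ, ∑' k, ‖ip v (frm (b ℓ) (Ml ℓ) k)‖ ^ 2)
    (v : (Fin d → ℤ) → ℂ) (hv : Summable (fun k => ‖v k‖ ^ 2)) (J : ℕ) :
    Summable (fun k => ‖ip v (ajk a M J k)‖ ^ 2) ∧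
      ∑' k : Fin d → ℤ, ‖v k‖ ^ 2 =
        (∑' k : Fin d → ℤ, ‖ip v (ajk a M J k)‖ ^ 2) +
          ∑ j ∈ Finset.Icc 1 J, ∑ ℓ : Fin s, ∑' k : Fin d → ℤ,
            ‖ip v (bjk a (b ℓ) M (Ml ℓ) j k)‖ ^ 2 := by
  induction J with
  | zero =>
    have e : ∀ k, ip v (ajk a M 0 k) = v k := by
      intro k
      rw [ip, tsum_eq_single k]
      · simp [ajk, aseq]
      · intro x hx
        simp [ajk, aseq, sub_eq_zero, hx]
    simp [e, hv]
  | succ J ih =>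
    obtain ⟨ihs, ihe⟩ := ih
    have hdet : (0 : ℝ) < ((|M.det| : ℤ) : ℝ) := by exact_mod_cast abs_pos.2 hM
    have hP : (M ^ J).det ≠ 0 := by rw [Matrix.det_pow]; exact pow_ne_zero _ hM
    have ea : ∀ k, ip v (ajk a M (J + 1) k) = ip (fun n => ip v (ajk a M J n)) (frm a M k) := by
      intro k
      have := cascade (aseq_summable ha hM J) ha hP v hv
        ((((|M.det| : ℤ) : ℝ) ^ ((J : ℝ) / 2) : ℝ) : ℂ) (Real.sqrt ((|M.det| : ℤ) : ℝ) : ℂ)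
        (M.mulVec k)
      refine Eq.trans ?_ this
      congr 1
      ext x
      rw [ajk, aseq, pow_succ, ← Matrix.mulVec_mulVec, ← Complex.ofReal_mul, Real.sqrt_eq_rpow,
        ← Real.rpow_add hdet]
      congr 4
      push_cast
      ring
    have eb : ∀ ℓ k, ip v (bjk a (b ℓ) M (Ml ℓ) (J + 1) k) =
        ip (fun n => ip v (ajk a M J n)) (frm (b ℓ) (Ml ℓ) k) := by
      intro ℓ k
      have := cascade (aseq_summable ha hM J) (hb ℓ) hP v hv
        ((((|M.det| : ℤ) : ℝ) ^ ((J : ℝ) / 2) : ℝ) : ℂ) (Real.sqrt ((|(Ml ℓ).det| : ℤ) : ℝ) : ℂ)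
        ((Ml ℓ).mulVec k)
      refine Eq.trans ?_ this
      congr 1
      ext x
      simp only [bjk, bseq, Nat.add_sub_cancel]
      congr 5
      push_cast
      ring
    refine ⟨?_, ?_⟩
    · simp only [ea]
      exact ip_frm_summable a ha M hM _ ihs
    · rw [ihe, h1 _ ihs, Finset.sum_Icc_succ_top (by omega)]
      simp only [ea, eb]
      ring

theorem das_is_tight_frame_of_tight_framelet_filter_bank
    {d s : ℕ} (a : (Fin d → ℤ) → ℂ) (b : Fin s → (Fin d → ℤ) → ℂ)
    (ha : Summable fun k => ‖a k‖) (hb : ∀ ℓ, Summable fun k => ‖b ℓ k‖)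
    (M : Matrix (Fin d) (Fin d) ℤ) (Ml : Fin s → Matrix (Fin d) (Fin d) ℤ)
    (hM : M.det ≠ 0) (hMl : ∀ ℓ, (Ml ℓ).det ≠ 0)
    (hpart : ∀ᵐ ξ : Fin d → ℝ ∂volume,
      ‖fserd a ξ‖ ^ 2 + ∑ ℓ : Fin s, ‖fserd (b ℓ) ξ‖ ^ 2 = 1)
    (horth : ∀ ω ∈ (Omega M ∪ ⋃ ℓ : Fin s, Omega (Ml ℓ)) \ {0},
      ∀ᵐ ξ : Fin d → ℝ ∂volume,
        (if inLat M ω then (1 : ℂ) else 0) * fserd a ξ *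
            starRingEnd ℂ (fserd a (ξ + (2 * Real.pi) • ω)) +
          ∑ ℓ : Fin s, (if inLat (Ml ℓ) ω then (1 : ℂ) else 0) * fserd (b ℓ) ξ *
            starRingEnd ℂ (fserd (b ℓ) (ξ + (2 * Real.pi) • ω)) = 0) :
    ∀ J : ℕ, 1 ≤ J → ∀ v : (Fin d → ℤ) → ℂ, Summable (fun k => ‖v k‖ ^ 2) →
      ∑' k : Fin d → ℤ, ‖v k‖ ^ 2 =
        (∑' k : Fin d → ℤ, ‖ip v (ajk a M J k)‖ ^ 2) +
          ∑ j ∈ Finset.Icc 1 J, ∑ ℓ : Fin s, ∑' k : Fin d → ℤ,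
            ‖ip v (bjk a (b ℓ) M (Ml ℓ) j k)‖ ^ 2 := by
  intro J _ v hv
  refine (das_aux a b ha hb M Ml hM ?_ v hv J).2
  have hf : ∀ i : Option (Fin s), Summable fun k => ‖i.elim a b k‖ := by
    rintro (_ | ℓ)
    exacts [ha, hb ℓ]
  have hN : ∀ i : Option (Fin s), (i.elim M Ml).det ≠ 0 := by
    rintro (_ | ℓ)
    exacts [hM, hMl ℓ]
  have hK := kernel_id (fun i : Option (Fin s) => i.elim a b) hf (fun i => i.elim M Ml) hN ?_
  · intro w hw
    have := one_level (fun i : Option (Fin s) => i.elim a b) hf (fun i => i.elim M Ml) hN hK w hw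
    rwa [Fintype.sum_option] at this
  · intro ω hω
    have hω' : ω ∈ Omega M ∪ ⋃ ℓ : Fin s, Omega (Ml ℓ) := by
      obtain ⟨i, hi⟩ := Set.mem_iUnion.1 hω
      cases i with
      | none => exact Or.inl hi
      | some ℓ => exact Or.inr (Set.mem_iUnion.2 ⟨ℓ, hi⟩)
    by_cases h0 : ω = 0
    · subst h0
      have hl : ∀ N : Matrix (Fin d) (Fin d) ℤ, inLat N 0 := fun N => ⟨0, by ext j; simp⟩
      filter_upwards [hpart] with ξ hξ
      simp only [hl, if_true, smul_zero, add_zero, one_mul, Complex.mul_conj',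
        Fintype.sum_option, Option.elim]
      exact_mod_cast hξ
    · filter_upwards [horth ω ⟨hω', h0⟩] with ξ hξ
      rw [if_neg h0, Fintype.sum_option]
      refine Eq.trans ?_ hξ
      simp only [Option.elim, mul_assoc]
      rfl
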